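/- arXiv:1310.7695 — 10 statements merged into one kernel-verified Lean document; each statement's English description precedes it below -/
import Mathlib

section
/- Let X be a finite set and let R be a preorder on X (a reflexive and transitive relation, viewed as a subset of X × X). If R is not antisymmetric (i.e., R is not a partial order), then R is inessential. -/
/-- Composition of correspondences: `RS = {(x,z) : ∃ y, (x,y) ∈ R ∧ (y,z) ∈ S}`. -/
def CorrRel.comp {X Y Z : Type*} (R : Set (X × Y)) (S : Set (Y × Z)) : Set (X × Z) :=
  {p | ∃ y, (p.1, y) ∈ R ∧ (y, p.2) ∈ S}

/-- A relation on a finite set `X` is inessential if it factorizes through a set of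
cardinality strictly smaller than `|X|`. -/
def CorrRel.Inessential {X : Type*} [Fintype X] (R : Set (X × X)) : Prop :=
  ∃ m : ℕ, m < Fintype.card X ∧
    ∃ (S : Set (X × Fin m)) (T : Set (Fin m × X)), R = CorrRel.comp S T

/-- A relation is essential if it is not inessential. -/
def CorrRel.Essential {X : Type*} [Fintype X] (R : Set (X × X)) : Prop :=
  ¬ CorrRel.Inessential R

/-- The diagonal `Δ = {(x,x) : x ∈ X}`. -/
def CorrRel.diag (X : Type*) : Set (X × X) := {p | p.1 = p.2}

/-- The permutation relation `Δ_σ = {(σ x, x) : x ∈ X}`. -/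
def CorrRel.deltaPerm {X : Type*} (σ : Equiv.Perm X) : Set (X × X) :=
  {p | p.1 = σ p.2}

/-- A preorder which is not antisymmetric (i.e. not an order) is inessential. -/
theorem inessential_of_preorder_not_antisymm {X : Type*} [Fintype X] (R : Set (X × X))
    (hrefl : ∀ x : X, (x, x) ∈ R)
    (htrans : ∀ x y z : X, (x, y) ∈ R → (y, z) ∈ R → (x, z) ∈ R)
    (hnot : ¬ (∀ x y : X, (x, y) ∈ R → (y, x) ∈ R → x = y)) :
    CorrRel.Inessential R := by
  classical
  push Not at hnot
  obtain ⟨a, b, hab, hba, hne⟩ := hnot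
  let e := Fintype.equivFin {x : X // x ≠ a}
  refine ⟨Fintype.card {x : X // x ≠ a}, Fintype.card_subtype_lt (x := a) (by simp),
    {p | (p.1, (e.symm p.2 : X)) ∈ R}, {p | ((e.symm p.1 : X), p.2) ∈ R}, ?_⟩
  ext ⟨x, z⟩
  constructor
  · intro hxz
    by_cases hx : x = a
    · subst hx
      exact ⟨e ⟨b, hne.symm⟩, by simpa using hab, by simpa using htrans b x z hba hxz⟩
    · exact ⟨e ⟨x, hx⟩, by simpa using hrefl x, by simpa using hxz⟩
  · rintro ⟨y, hxy, hyz⟩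
    exact htrans _ _ _ hxy hyz
end

section
/- Let X be a finite set, let R be a (partial) order on X (a reflexive, transitive, antisymmetric relation viewed as a subset of X × X), and let Q be a reflexive relation on X with Q ⊆ R. Then Q is essential. In particular, every order on X is essential. -/
/-- If R is a (partial) order on X and Q is a reflexive relation contained in R,
then Q is essential.  In particular every order is essential. -/
theorem essential_of_reflexive_subset_order {X : Type*} [Fintype X] (R Q : Set (X × X))
    (hrefl : ∀ x : X, (x, x) ∈ R)
    (htrans : ∀ x y z : X, (x, y) ∈ R → (y, z) ∈ R → (x, z) ∈ R)
    (hanti : ∀ x y : X, (x, y) ∈ R → (y, x) ∈ R → x = y)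
    (hQrefl : ∀ x : X, (x, x) ∈ Q)
    (hQR : Q ⊆ R) :
    CorrRel.Essential Q := by
  rintro ⟨m, hm, S, T, rfl⟩
  choose f hfS hfT using hQrefl
  obtain ⟨x, y, hne, hxy⟩ :=
    Fintype.exists_ne_map_eq_of_card_lt f (by simpa using hm)
  exact hne (hanti x y (hQR ⟨f x, hfS x, hxy ▸ hfT y⟩) (hQR ⟨f y, hfS y, hxy ▸ hfT x⟩))
end

section
/- Let X be a finite set and let R be a total order on X (a reflexive, transitive, antisymmetric relation in which any two elements are comparable, viewed as a subset of X × X). Then R is maximal among essential relations: any relation S on X with R ⊊ S is inessential. -/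
/-- If every element of the row of `i` lies in the row of some `y ≠ i` that is contained in the
row of `i`, then the relation is inessential. -/
theorem CorrRel.Inessential.of_row_covered {X : Type*} [Fintype X] {S : Set (X × X)} (i : X)
    (h : ∀ z, (i, z) ∈ S → ∃ y, y ≠ i ∧ (y, z) ∈ S ∧ ∀ w, (y, w) ∈ S → (i, w) ∈ S) :
    CorrRel.Inessential S := by
  classical
  let e := Fintype.equivFin {y : X // y ≠ i}
  refine ⟨Fintype.card {y : X // y ≠ i}, Fintype.card_subtype_lt (x := i) (by simp),
    {p | ∀ w, ((e.symm p.2 : X), w) ∈ S → (p.1, w) ∈ S}, {p | ((e.symm p.1 : X), p.2) ∈ S}, ?_⟩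
  ext ⟨x, z⟩
  constructor
  · intro hxz
    obtain ⟨y, hy, hyz, hyx⟩ :
        ∃ y, y ≠ i ∧ (y, z) ∈ S ∧ ∀ w, (y, w) ∈ S → (x, w) ∈ S := by
      by_cases hx : x = i
      · subst hx
        exact h z hxz
      · exact ⟨x, hx, hxz, fun _ hw => hw⟩
    exact ⟨e ⟨y, hy⟩, by simpa using hyx, by simpa using hyz⟩
  · rintro ⟨k, hk, hkz⟩
    exact hk z hkz

/-- A total order is maximal among essential relations: any relation strictly
containing it is inessential. -/
theorem inessential_of_ssuperset_total_order {X : Type*} [Fintype X] (R : Set (X × X))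
    (hrefl : ∀ x : X, (x, x) ∈ R)
    (htrans : ∀ x y z : X, (x, y) ∈ R → (y, z) ∈ R → (x, z) ∈ R)
    (hanti : ∀ x y : X, (x, y) ∈ R → (y, x) ∈ R → x = y)
    (htotal : ∀ x y : X, (x, y) ∈ R ∨ (y, x) ∈ R)
    (S : Set (X × X)) (hRS : R ⊂ S) :
    CorrRel.Inessential S := by
  classical
  obtain ⟨hsub, hne⟩ := hRS
  obtain ⟨⟨a, b⟩, hab, hab'⟩ := Set.not_subset.mp hne
  let _ : PartialOrder X :=
    { le := fun x y => (x, y) ∈ R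
      le_refl := hrefl
      le_trans := htrans
      le_antisymm := hanti }
  obtain ⟨i, ⟨j, hjS, hjR⟩, hmin⟩ :=
    (Set.toFinite {i : X | ∃ j, (j, i) ∈ S ∧ (j, i) ∉ R}).exists_minimal ⟨b, a, hab, hab'⟩
  have extra_ge : ∀ v w, (v, w) ∈ S → (v, w) ∉ R → (i, w) ∈ R := fun v w hS hR =>
    (htotal i w).elim id fun hwi => hmin ⟨v, hS, hR⟩ hwi
  have row_subset : ∀ y, (i, y) ∈ R → ∀ w, (y, w) ∈ S → (i, w) ∈ R := fun y hy w hw =>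
    if hR : (y, w) ∈ R then htrans _ _ _ hy hR else extra_ge y w hw hR
  refine .of_row_covered i fun z hz => ?_
  by_cases hzi : z = i
  · subst hzi
    exact ⟨j, fun hj => hjR (hj ▸ hrefl j), hjS, fun w hw =>
      hsub (row_subset j ((htotal z j).resolve_right hjR) w hw)⟩
  · exact ⟨z, hzi, hsub (hrefl z), fun w hw =>
      hsub (row_subset z (row_subset i (hrefl i) z hz) w hw)⟩
end

section
/- Let X be a finite set with n = |X| ≥ 5, let Δ be the diagonal of X × X, and let R = (X × X) \ Δ be the complement of the diagonal. Then R is inessential. -/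
/-- If the 2-element subsets of `Fin m` are numerous enough to label the points of `X`, then the
complement of the diagonal of `X` factorizes through `Fin m`. -/
theorem CorrRel.exists_comp_eq_compl_diag {X : Type*} [Fintype X] {m : ℕ}
    (h : Fintype.card X ≤ m.choose 2) :
    ∃ (S : Set (X × Fin m)) (T : Set (Fin m × X)),
      {p : X × X | p.1 ≠ p.2} = CorrRel.comp S T := by
  obtain ⟨f⟩ : Nonempty (X ↪ (Finset.univ : Finset (Fin m)).powersetCard 2) :=
    Function.Embedding.nonempty_of_card_le (by simpa using h)
  have hcard (x : X) : (f x).1.card = 2 := (Finset.mem_powersetCard.1 (f x).2).2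
  refine ⟨{p | p.2 ∈ (f p.1).1}, {p | p.1 ∉ (f p.2).1}, ?_⟩
  ext ⟨x, z⟩
  change x ≠ z ↔ ∃ i, i ∈ (f x).1 ∧ i ∉ (f z).1
  rw [← Finset.not_subset, not_iff_not]
  refine ⟨fun hxz => hxz ▸ subset_rfl, fun hsub => f.injective (Subtype.ext ?_)⟩
  exact Finset.eq_of_subset_of_card_le hsub (by rw [hcard, hcard])

/-- For a finite set of cardinality at least 5, the complement of the diagonal is
inessential. -/
theorem inessential_compl_diag {X : Type*} [Fintype X] (hX : 5 ≤ Fintype.card X) :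
    CorrRel.Inessential {p : X × X | p.1 ≠ p.2} := by
  refine ⟨Fintype.card X - 1, by omega, CorrRel.exists_comp_eq_compl_diag ?_⟩
  obtain ⟨k, hk⟩ := Nat.exists_eq_add_of_le' hX
  rw [hk, Nat.add_sub_assoc (by norm_num), Nat.choose_two_right,
    Nat.le_div_iff_mul_le two_pos]
  simp only [Nat.reduceSub, Nat.add_sub_assoc, Nat.reduceLeDiff]
  nlinarith
end

section
/- Let X be a finite set. The left action of the symmetric group of X on the set of essential relations on X, given by σ · R = Δ_σ R (composition of correspondences), is free: if R is an essential relation on X and σ is a permutation of X with Δ_σ R = R, then σ is the identity. -/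
/-- A relation with two equal rows is inessential. -/
theorem CorrRel.inessential_of_rows_eq {X : Type*} [Fintype X] {R : Set (X × X)} {a b : X}
    (hab : a ≠ b) (h : ∀ z, (a, z) ∈ R ↔ (b, z) ∈ R) : CorrRel.Inessential R := by
  classical
  let e := Fintype.equivFin {x : X // x ≠ a}
  refine ⟨Fintype.card {x : X // x ≠ a}, Fintype.card_subtype_lt (x := a) (by simp),
    {p | ∀ z, (p.1, z) ∈ R ↔ ((e.symm p.2 : X), z) ∈ R},
    {p | ((e.symm p.1 : X), p.2) ∈ R}, ?_⟩
  ext ⟨x, z⟩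
  constructor
  · intro hx
    by_cases hxa : x = a
    · subst hxa
      refine ⟨e ⟨b, hab.symm⟩, ?_, ?_⟩
      · simpa using h
      · simpa using (h z).1 hx
    · exact ⟨e ⟨x, hxa⟩, by simp, by simpa using hx⟩
  · rintro ⟨y, hy, hz⟩
    exact (hy z).2 hz

/-- The row of `Δ_σ R` at `σ x` is the row of `R` at `x`. -/
theorem CorrRel.mem_comp_deltaPerm {X : Type*} (σ : Equiv.Perm X) (R : Set (X × X)) (x z : X) :
    (σ x, z) ∈ CorrRel.comp (CorrRel.deltaPerm σ) R ↔ (x, z) ∈ R := by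
  simp [CorrRel.comp, CorrRel.deltaPerm]

/-- The left action of the symmetric group on essential relations is free. -/
theorem deltaPerm_action_free {X : Type*} [Fintype X] (R : Set (X × X))
    (hR : CorrRel.Essential R) (σ : Equiv.Perm X)
    (hfix : CorrRel.comp (CorrRel.deltaPerm σ) R = R) :
    σ = 1 := by
  by_contra hσ
  obtain ⟨a, ha⟩ : ∃ a, σ a ≠ a := by
    by_contra! h
    exact hσ (Equiv.ext h)
  refine hR (CorrRel.inessential_of_rows_eq ha fun z => ?_)
  rw [← CorrRel.mem_comp_deltaPerm σ R a z, hfix]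
end

section
/- Let X be a finite set and let R be an essential relation on X. Then R contains a permutation: there exists a permutation σ of X such that Δ_σ = {(σ(x), x) : x ∈ X} ⊆ R. -/
/-- A relation factorizing through any finite type smaller than `X` is inessential. -/
theorem CorrRel.inessential_of_comp {X Y : Type*} [Fintype X] [Fintype Y] (R : Set (X × X))
    (hY : Fintype.card Y < Fintype.card X) (S : Set (X × Y)) (T : Set (Y × X))
    (hR : R = CorrRel.comp S T) : CorrRel.Inessential R := by
  let e := Fintype.equivFin Y
  refine ⟨Fintype.card Y, hY, {p | (p.1, e.symm p.2) ∈ S}, {p | (e.symm p.1, p.2) ∈ T}, ?_⟩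
  rw [hR]
  ext p
  exact e.symm.surjective.exists

/-- If the vertices in `A` are related to fewer than `#A` vertices altogether, then the relation
factorizes through the disjoint union of these vertices and the complement of `A`. -/
theorem CorrRel.inessential_of_card_lt {X : Type*} [Fintype X] (R : Set (X × X))
    (A N : Finset X) (hN : ∀ a ∈ A, ∀ b, (b, a) ∈ R → b ∈ N) (hcard : N.card < A.card) :
    CorrRel.Inessential R := by
  classical
  refine CorrRel.inessential_of_comp (Y := N ⊕ {c // c ∉ A}) R ?_
    {p | Sum.elim (fun b => p.1 = b.1) (fun c => (p.1, c.1) ∈ R) p.2}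
    {p | Sum.elim (fun b => (b.1, p.2) ∈ R) (fun c => p.2 = c.1) p.1} ?_
  · have hA : A.card ≤ Fintype.card X := A.card_le_univ
    simp only [Fintype.card_sum, Fintype.card_coe, Fintype.card_subtype_compl]
    omega
  · ext ⟨x, z⟩
    constructor
    · intro h
      by_cases hz : z ∈ A
      · exact ⟨Sum.inl ⟨x, hN z hz x h⟩, rfl, h⟩
      · exact ⟨Sum.inr ⟨z, hz⟩, h, rfl⟩
    · rintro ⟨b | c, h, h'⟩
      · have hx : x = b.1 := h
        rw [hx]
        exact h'
      · have hz : z = c.1 := h'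
        rw [hz]
        exact h

/-- Every essential relation contains a permutation. -/
theorem essential_contains_perm {X : Type*} [Fintype X] (R : Set (X × X))
    (hR : CorrRel.Essential R) :
    ∃ σ : Equiv.Perm X, CorrRel.deltaPerm σ ⊆ R := by
  classical
  have hall : ∀ A : Finset X,
      A.card ≤ (Finset.univ.filter fun b => ∃ a ∈ A, (b, a) ∈ R).card := by
    intro A
    by_contra! hA
    refine hR (CorrRel.inessential_of_card_lt R A _ (fun a ha b hab => ?_) hA)
    exact Finset.mem_filter.2 ⟨Finset.mem_univ b, a, ha, hab⟩
  obtain ⟨f, hf, hfR⟩ :=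
    (Fintype.all_card_le_filter_rel_iff_exists_injective fun a b => (b, a) ∈ R).1 hall
  refine ⟨Equiv.ofBijective f (Finite.injective_iff_bijective.1 hf), ?_⟩
  rintro ⟨x, z⟩ h
  have hx : x = f z := h
  rw [hx]
  exact hfR z
end

section
/- Let X be a finite set and let R be an essential relation on X. Then R satisfies the Hall condition: for every subset A ⊆ X, the set R_A = {x ∈ X : ∃ a ∈ A, (x,a) ∈ R} has cardinality at least |A|. -/
/-- A relation factoring through a finite type with fewer elements than `X` is inessential. -/
theorem CorrRel.Inessential.of_comp {X Y : Type*} [Fintype X] [Finite Y] {R : Set (X × X)}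
    (hY : Nat.card Y < Fintype.card X) (S : Set (X × Y)) (T : Set (Y × X))
    (h : R = CorrRel.comp S T) : CorrRel.Inessential R := by
  let e := Finite.equivFin Y
  refine ⟨Nat.card Y, hY, {p | (p.1, e.symm p.2) ∈ S}, {p | (e.symm p.1, p.2) ∈ T}, ?_⟩
  subst h
  ext ⟨x, z⟩
  exact e.symm.surjective.exists

/-- Every essential relation satisfies the Hall condition. -/
theorem essential_hall_condition {X : Type*} [Fintype X] (R : Set (X × X))
    (hR : CorrRel.Essential R) (A : Set X) :
    A.ncard ≤ {x : X | ∃ a ∈ A, (x, a) ∈ R}.ncard := by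
  by_contra! hlt
  apply hR
  set B : Set X := {x : X | ∃ a ∈ A, (x, a) ∈ R}
  have hcard : Nat.card (B ⊕ (Aᶜ : Set X)) < Fintype.card X := by
    rw [Nat.card_sum, Nat.card_coe_set_eq, Nat.card_coe_set_eq, ← Nat.card_eq_fintype_card,
      ← Set.ncard_add_ncard_compl A]
    omega
  refine CorrRel.Inessential.of_comp hcard
    {p | Sum.elim (fun b => p.1 = b.1) (fun c => (p.1, c.1) ∈ R) p.2}
    {p | Sum.elim (fun b => (b.1, p.2) ∈ R) (fun c => c.1 = p.2) p.1} ?_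
  ext ⟨x, z⟩
  constructor
  · intro h
    by_cases hz : z ∈ A
    · exact ⟨Sum.inl ⟨x, z, hz, h⟩, rfl, h⟩
    · exact ⟨Sum.inr ⟨z, hz⟩, h, rfl⟩
  · rintro ⟨b | c, h₁, h₂⟩
    · obtain rfl : x = b.1 := h₁
      exact h₂
    · obtain rfl : c.1 = z := h₂
      exact h₁
end

section
/- Let X be a finite set, let R be a (partial) order on X, and let S, S′ be relations on X. Then the following are equivalent: (a) Δ ⊆ S′S ⊆ R (where S′S is composition of correspondences and Δ is the diagonal); (b) there exists a permutation σ of X such that Δ ⊆ Δ_{σ⁻¹} S ⊆ R and Δ ⊆ S′ Δ_σ ⊆ R. Moreover, in (b) the permutation σ is unique. -/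
theorem CorrRel.mk_mem_comp_deltaPerm {X : Type*} (S : Set (X × X)) (σ : Equiv.Perm X) (x z : X) :
    (x, z) ∈ CorrRel.comp S (CorrRel.deltaPerm σ) ↔ (x, σ z) ∈ S := by
  simp [CorrRel.comp, CorrRel.deltaPerm]

theorem CorrRel.mk_mem_deltaPerm_inv_comp {X : Type*} (S : Set (X × X)) (σ : Equiv.Perm X)
    (x z : X) :
    (x, z) ∈ CorrRel.comp (CorrRel.deltaPerm σ⁻¹) S ↔ (σ x, z) ∈ S := by
  simp [CorrRel.comp, CorrRel.deltaPerm, Equiv.eq_symm_apply]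

theorem CorrRel.diag_subset_iff {X : Type*} (T : Set (X × X)) :
    CorrRel.diag X ⊆ T ↔ ∀ x, (x, x) ∈ T := by
  simp [Set.subset_def, CorrRel.diag]

/-- For an order R and relations S, S': the sandwich condition Δ ⊆ S'S ⊆ R holds iff
there exists a permutation σ with Δ ⊆ Δ_{σ⁻¹} S ⊆ R and Δ ⊆ S' Δ_σ ⊆ R; moreover
such a permutation σ is unique. -/
theorem sandwich_iff_perm {X : Type*} [Fintype X] (R : Set (X × X))
    (hrefl : ∀ x : X, (x, x) ∈ R)
    (htrans : ∀ x y z : X, (x, y) ∈ R → (y, z) ∈ R → (x, z) ∈ R)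
    (hanti : ∀ x y : X, (x, y) ∈ R → (y, x) ∈ R → x = y)
    (S S' : Set (X × X)) :
    ((CorrRel.diag X ⊆ CorrRel.comp S' S ∧ CorrRel.comp S' S ⊆ R) ↔
      ∃ σ : Equiv.Perm X,
        (CorrRel.diag X ⊆ CorrRel.comp (CorrRel.deltaPerm σ⁻¹) S ∧
          CorrRel.comp (CorrRel.deltaPerm σ⁻¹) S ⊆ R) ∧
        (CorrRel.diag X ⊆ CorrRel.comp S' (CorrRel.deltaPerm σ) ∧
          CorrRel.comp S' (CorrRel.deltaPerm σ) ⊆ R)) ∧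
    (∀ σ τ : Equiv.Perm X,
      ((CorrRel.diag X ⊆ CorrRel.comp (CorrRel.deltaPerm σ⁻¹) S ∧
          CorrRel.comp (CorrRel.deltaPerm σ⁻¹) S ⊆ R) ∧
        (CorrRel.diag X ⊆ CorrRel.comp S' (CorrRel.deltaPerm σ) ∧
          CorrRel.comp S' (CorrRel.deltaPerm σ) ⊆ R)) →
      ((CorrRel.diag X ⊆ CorrRel.comp (CorrRel.deltaPerm τ⁻¹) S ∧
          CorrRel.comp (CorrRel.deltaPerm τ⁻¹) S ⊆ R) ∧
        (CorrRel.diag X ⊆ CorrRel.comp S' (CorrRel.deltaPerm τ) ∧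
          CorrRel.comp S' (CorrRel.deltaPerm τ) ⊆ R)) →
      σ = τ) := by
  simp only [CorrRel.diag_subset_iff]
  simp only [Set.subset_def, Prod.forall,
    CorrRel.mk_mem_comp_deltaPerm, CorrRel.mk_mem_deltaPerm_inv_comp]
  refine ⟨⟨?_, ?_⟩, ?_⟩
  · rintro ⟨hdiag, hR⟩
    choose f hS' hS using hdiag
    have hf : Function.Injective f := by
      intro x y hxy
      refine hanti x y (hR x y ⟨f x, hS' x, ?_⟩) (hR y x ⟨f x, ?_, hS x⟩)
      · exact hxy ▸ hS y
      · exact hxy ▸ hS' y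
    refine ⟨Equiv.ofBijective f (Finite.injective_iff_bijective.mp hf),
      ⟨hS, fun x z h => hR x z ⟨f x, hS' x, h⟩⟩, hS', fun x z h => hR x z ⟨f z, h, hS z⟩⟩
  · rintro ⟨σ, ⟨hS, hSR⟩, hS', hS'R⟩
    refine ⟨fun x => ⟨σ x, hS' x, hS x⟩, ?_⟩
    rintro x z ⟨y, hxy, hyz⟩
    obtain ⟨w, rfl⟩ := σ.surjective y
    exact htrans x w z (hS'R x w hxy) (hSR w z hyz)
  · rintro σ τ ⟨⟨hS, -⟩, hS', -⟩ ⟨⟨-, hSR⟩, -, hS'R⟩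
    ext x
    obtain ⟨w, hw⟩ := τ.surjective (σ x)
    have hwx : w = x := hanti w x (hSR w x (hw ▸ hS x)) (hS'R x w (hw ▸ hS' x))
    rw [← hw, hwx]
end

section
/- Let k be a field and let B be a (possibly noncommutative) k-algebra that is finite-dimensional as a k-vector space. Let I be a two-sided ideal of B that is spanned, as a k-vector space, by a set of nilpotent elements of B. Then I is a nilpotent ideal: there exists a positive integer m such that every product of m elements of I is zero. -/
theorem Ideal.list_prod_mem_pow {R : Type*} [Ring R] (J : Ideal R) [J.IsTwoSided]
    (l : List R) (hl : ∀ x ∈ l, x ∈ J) : l.prod ∈ J ^ l.length := by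
  induction l with
  | nil => simp [Submodule.pow_zero, Ideal.one_eq_top]
  | cons x l ih =>
    rw [List.prod_cons, List.length_cons, Ideal.IsTwoSided.pow_succ]
    exact Ideal.mul_mem_mul (hl x (by simp)) (ih fun y hy ↦ hl y (by simp [hy]))

theorem map_mem_span_isNilpotent {K C D : Type*} [CommRing K] [Ring C] [Algebra K C]
    [Ring D] [Algebra K D] (f : C →ₐ[K] D) {x : C}
    (hx : x ∈ Submodule.span K {y : C | IsNilpotent y}) :
    f x ∈ Submodule.span K {y : D | IsNilpotent y} := by
  have h : Submodule.span K {y : C | IsNilpotent y} ≤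
      (Submodule.span K {y : D | IsNilpotent y}).comap f.toLinearMap :=
    Submodule.span_le.2 fun y hy ↦ Submodule.subset_span (hy.map f)
  exact h hx

theorem Matrix.trace_eq_zero_of_mem_span_isNilpotent {K n : Type*} [Field K] [Fintype n]
    [DecidableEq n] {x : Matrix n n K}
    (hx : x ∈ Submodule.span K {y : Matrix n n K | IsNilpotent y}) : x.trace = 0 := by
  have h : Submodule.span K {y : Matrix n n K | IsNilpotent y} ≤
      LinearMap.ker (Matrix.traceLinearMap n K K) :=
    Submodule.span_le.2 fun y hy ↦ (Matrix.isNilpotent_trace_of_isNilpotent hy).eq_zero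
  exact h hx

/-- Over an algebraically closed field, an element of a finite-dimensional algebra all of whose
left multiples are combinations of nilpotent elements lies in the Jacobson radical. -/
theorem mem_jacobson_of_forall_mul_mem_span_isNilpotent {K C : Type*} [Field K] [IsAlgClosed K]
    [Ring C] [Algebra K C] [FiniteDimensional K C] {x : C}
    (hx : ∀ c : C, c * x ∈ Submodule.span K {y : C | IsNilpotent y}) :
    x ∈ Ring.jacobson C := by
  have := IsArtinianRing.of_finite K C
  have : FiniteDimensional K (C ⧸ Ring.jacobson C) :=
    Module.Finite.of_surjective (Ideal.Quotient.mkₐ K (Ring.jacobson C)).toLinearMap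
      Ideal.Quotient.mk_surjective
  obtain ⟨n, d, -, ⟨e⟩⟩ :=
    IsSemisimpleRing.exists_algEquiv_pi_matrix_of_isAlgClosed K (C ⧸ Ring.jacobson C)
  rw [← Ideal.Quotient.eq_zero_iff_mem, ← e.map_eq_zero_iff]
  funext i
  refine Matrix.ext_iff_trace_mul_left.2 fun z ↦ ?_
  obtain ⟨q, hq⟩ := e.surjective (Pi.single i z)
  obtain ⟨c, rfl⟩ := Ideal.Quotient.mk_surjective q
  have h := Matrix.trace_eq_zero_of_mem_span_isNilpotent <| map_mem_span_isNilpotent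
    ((Pi.evalAlgHom K (fun i ↦ Matrix (Fin (d i)) (Fin (d i)) K) i).comp
      (e.toAlgHom.comp (Ideal.Quotient.mkₐ K (Ring.jacobson C)))) (hx c)
  have hc : (e (Ideal.Quotient.mk _ c)) i = z := by rw [hq, Pi.single_eq_same]
  simpa [hc] using h

open scoped TensorProduct in
theorem tmul_mem_span_isNilpotent {k B : Type*} (K : Type*) [Field k] [Ring B] [Algebra k B]
    [Field K] [Algebra k K] (a : K) {b : B}
    (hb : b ∈ Submodule.span k {y : B | IsNilpotent y}) :
    a ⊗ₜ[k] b ∈ Submodule.span K {y : K ⊗[k] B | IsNilpotent y} := by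
  induction hb using Submodule.span_induction with
  | mem y hy =>
    have h := (Submodule.span K {y : K ⊗[k] B | IsNilpotent y}).smul_mem a
      (Submodule.subset_span (hy.map (Algebra.TensorProduct.includeRight : B →ₐ[k] K ⊗[k] B)))
    simpa [TensorProduct.smul_tmul'] using h
  | zero => simp
  | add y z _ _ hy hz => rw [TensorProduct.tmul_add]; exact add_mem hy hz
  | smul c y _ hy =>
    rw [TensorProduct.tmul_smul]
    exact Submodule.smul_of_tower_mem _ c hy


/-- Let k be a field and B a finite-dimensional k-algebra.  A two-sided ideal of B
which is k-linearly spanned by a set of nilpotent elements is a nilpotent ideal: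
there is a positive integer m such that every product of m elements of the ideal
vanishes. -/
theorem nilpotent_ideal_of_spanned_by_nilpotents {k : Type*} [Field k]
    {B : Type*} [Ring B] [Algebra k B] [FiniteDimensional k B]
    (I : Submodule k B)
    (hleft : ∀ a : B, ∀ b ∈ I, a * b ∈ I)
    (hright : ∀ a : B, ∀ b ∈ I, b * a ∈ I)
    (s : Set B) (hs : ∀ x ∈ s, IsNilpotent x)
    (hspan : Submodule.span k s = I) :
    ∃ m : ℕ, 0 < m ∧
      ∀ l : List B, l.length = m → (∀ x ∈ l, x ∈ I) → l.prod = 0 := by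
  let K := AlgebraicClosure k
  let C := TensorProduct k K B
  let ι : B →ₐ[k] C := Algebra.TensorProduct.includeRight
  have hι : Function.Injective ι :=
    Algebra.TensorProduct.includeRight_injective (algebraMap k K).injective
  have hI : I ≤ Submodule.span k {y : B | IsNilpotent y} := hspan ▸ Submodule.span_mono hs
  have hJ : ∀ x ∈ I, ι x ∈ Ring.jacobson C := fun x hx ↦ by
    refine mem_jacobson_of_forall_mul_mem_span_isNilpotent (K := K) fun c ↦ ?_
    induction c using TensorProduct.induction_on with
    | zero => simp
    | tmul a b =>
      rw [Algebra.TensorProduct.includeRight_apply, Algebra.TensorProduct.tmul_mul_tmul, mul_one]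
      exact tmul_mem_span_isNilpotent K a (hI (hleft b x hx))
    | add c d hc hd => rw [add_mul]; exact add_mem hc hd
  have := IsArtinianRing.of_finite K C
  obtain ⟨m, hm⟩ := IsSemiprimaryRing.isNilpotent (R := C)
  refine ⟨m + 1, m.succ_pos, fun l hl hlI ↦ hι ?_⟩
  have h := Ideal.list_prod_mem_pow (Ring.jacobson C) (l.map ι)
    (by simpa using fun x hx ↦ hJ x (hlI x hx))
  rw [List.length_map, hl, Submodule.pow_succ, hm, zero_mul] at h
  rw [map_list_prod, map_zero]
  exact h
end

section
/- Let P be a finite lattice with minimal element 0 and join ∨, and let μ denote the Möbius function of the poset P (with values in ℤ). Let A be a ring and let (g_x)_{x∈P} be a family of elements of A such that g_0 = 1 and g_x g_y = g_{x∨y} for all x, y ∈ P. For each x ∈ P define f_x = Σ_{y ≥ x} μ(x,y) · g_y (integer multiples in A). Then: (a) for all x, z ∈ P, g_z f_x = f_x g_z, and this product equals f_x if z ≤ x and equals 0 if z ≰ x; (b) the elements (f_x)_{x∈P} are mutually orthogonal idempotents of A (f_x f_x = f_x and f_x f_u = 0 for x ≠ u) whose sum over all x ∈ P equals 1. -/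
/-- The defining recursion of the Möbius function, for arbitrary pairs. -/
theorem moebius_sum_right {P : Type*} [PartialOrder P] [Fintype P] [DecidableEq P]
    [DecidableRel ((· ≤ ·) : P → P → Prop)] (μ : P → P → ℤ)
    (hμdiag : ∀ x : P, μ x x = 1)
    (hμsum : ∀ x w : P, x < w →
      (∑ y ∈ Finset.univ.filter (fun y => x ≤ y ∧ y ≤ w), μ x y) = 0) (x w : P) :
    (∑ y ∈ Finset.univ.filter (fun y => x ≤ y ∧ y ≤ w), μ x y) = if x = w then 1 else 0 := by
  split_ifs with h
  · subst h
    have : Finset.univ.filter (fun y => x ≤ y ∧ y ≤ x) = {x} := by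
      ext y
      simp [le_antisymm_iff, and_comm]
    rw [this, Finset.sum_singleton, hμdiag]
  · by_cases hxw : x ≤ w
    · exact hμsum x w (lt_of_le_of_ne hxw h)
    · refine Finset.sum_eq_zero fun y hy => absurd ?_ hxw
      simp only [Finset.mem_filter] at hy
      exact hy.2.1.trans hy.2.2

/-- The dual recursion: the Möbius function is also a left inverse of the zeta function. -/
theorem moebius_sum_left {P : Type*} [PartialOrder P] [Fintype P] [DecidableEq P]
    [DecidableRel ((· ≤ ·) : P → P → Prop)] (μ : P → P → ℤ)
    (hμ : ∀ x w : P, (∑ y ∈ Finset.univ.filter (fun y => x ≤ y ∧ y ≤ w), μ x y) =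
      if x = w then 1 else 0) (x w : P) :
    (∑ y ∈ Finset.univ.filter (fun y => x ≤ y ∧ y ≤ w), μ y w) = if x = w then 1 else 0 := by
  let M : Matrix P P ℤ := Matrix.of fun a b => if a ≤ b then μ a b else 0
  let Z : Matrix P P ℤ := Matrix.of fun a b => if a ≤ b then 1 else 0
  have hMZ : M * Z = 1 := by
    ext a b
    rw [Matrix.one_apply, ← hμ a b, Matrix.mul_apply, Finset.sum_filter]
    refine Finset.sum_congr rfl fun y _ => ?_
    by_cases h₁ : a ≤ y <;> by_cases h₂ : y ≤ b <;> simp [M, Z, h₁, h₂]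
  have hZM : Z * M = 1 := mul_eq_one_comm.mp hMZ
  rw [← Matrix.one_apply, ← hZM, Matrix.mul_apply, Finset.sum_filter]
  refine Finset.sum_congr rfl fun y _ => ?_
  by_cases h₁ : x ≤ y <;> by_cases h₂ : y ≤ w <;> simp [M, Z, h₁, h₂]

/-- Weisner's theorem: the Möbius values over the fibre of `(· ⊔ z)` at `w` cancel. -/
theorem moebius_sum_sup_eq_zero {P : Type*} [Lattice P] [Fintype P] [DecidableEq P]
    [DecidableRel ((· ≤ ·) : P → P → Prop)] (μ : P → P → ℤ)
    (hμsum : ∀ x w : P, x < w →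
      (∑ y ∈ Finset.univ.filter (fun y => x ≤ y ∧ y ≤ w), μ x y) = 0)
    {x z : P} (hzx : ¬ z ≤ x) (w : P) :
    (∑ y ∈ Finset.univ.filter (fun y => x ≤ y ∧ y ⊔ z = w), μ x y) = 0 := by
  induction w using WellFoundedLT.induction with
  | ind w ih =>
    by_cases hw : x ⊔ z ≤ w
    · have hxw : x < w := lt_of_le_of_ne (le_sup_left.trans hw) fun h =>
        hzx (h ▸ le_sup_right.trans hw)
      have hzw : z ≤ w := le_sup_right.trans hw
      have key : ∀ v ≤ w,
          (Finset.univ.filter (fun y => x ≤ y ∧ y ≤ w)).filter (fun y => y ⊔ z = v) =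
            Finset.univ.filter (fun y => x ≤ y ∧ y ⊔ z = v) := by
        intro v hv
        ext y
        simp only [Finset.mem_filter, Finset.mem_univ, true_and]
        exact ⟨fun h => ⟨h.1.1, h.2⟩, fun h =>
          ⟨⟨h.1, le_sup_left.trans (h.2.le.trans hv)⟩, h.2⟩⟩
      have htotal := hμsum x w hxw
      rw [← Finset.sum_fiberwise_of_maps_to (t := Finset.univ.filter (· ≤ w)) (g := (· ⊔ z))
        (fun y hy => by
          simp only [Finset.mem_filter, Finset.mem_univ, true_and] at hy ⊢
          exact sup_le hy.2 hzw),
        Finset.sum_eq_single_of_mem w (by simp), key w le_rfl] at htotal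
      · exact htotal
      intro v hv hvw
      have hv' : v ≤ w := by simpa using hv
      rw [key v hv']
      exact ih v (lt_of_le_of_ne hv' hvw)
    · refine Finset.sum_eq_zero fun y hy => absurd ?_ hw
      simp only [Finset.mem_filter, Finset.mem_univ, true_and] at hy
      exact hy.2 ▸ sup_le_sup_right hy.1 z

/-- Möbius inversion for a family of idempotents indexed by a finite lattice:
if g : P → A satisfies g ⊥ = 1 and g x * g y = g (x ⊔ y), and
f x = Σ_{y ≥ x} μ x y • g y where μ is the Möbius function of P, then
g z * f x = f x * g z, equal to f x when z ≤ x and to 0 otherwise, and the f x are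
mutually orthogonal idempotents summing to 1. -/
theorem moebius_orthogonal_idempotents {P : Type*} [Lattice P] [OrderBot P] [Fintype P]
    [DecidableRel ((· ≤ ·) : P → P → Prop)]
    (μ : P → P → ℤ)
    (hμdiag : ∀ x : P, μ x x = 1)
    (hμsum : ∀ x w : P, x < w →
      (∑ y ∈ Finset.univ.filter (fun y => x ≤ y ∧ y ≤ w), μ x y) = 0)
    {A : Type*} [Ring A]
    (g : P → A) (hg0 : g ⊥ = 1) (hgmul : ∀ x y : P, g x * g y = g (x ⊔ y))
    (f : P → A)
    (hf : ∀ x : P, f x = ∑ y ∈ Finset.univ.filter (fun y => x ≤ y), μ x y • g y) :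
    (∀ x z : P, g z * f x = f x * g z ∧
        (z ≤ x → g z * f x = f x) ∧ (¬ z ≤ x → g z * f x = 0)) ∧
    (∀ x : P, f x * f x = f x) ∧
    (∀ x u : P, x ≠ u → f x * f u = 0) ∧
    (∑ x : P, f x = 1) := by
  classical
  have hμ := moebius_sum_right μ hμdiag hμsum
  have hcomm : ∀ x z : P, g z * f x = f x * g z := fun x z => by
    simp only [hf, Finset.mul_sum, Finset.sum_mul, mul_smul_comm, smul_mul_assoc, hgmul,
      sup_comm z]
  have hle : ∀ x z : P, z ≤ x → g z * f x = f x := fun x z hzx => by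
    rw [hf, Finset.mul_sum]
    refine Finset.sum_congr rfl fun y hy => ?_
    simp only [Finset.mem_filter, Finset.mem_univ, true_and] at hy
    rw [mul_smul_comm, hgmul, sup_eq_right.mpr (hzx.trans hy)]
  have hnle : ∀ x z : P, ¬ z ≤ x → g z * f x = 0 := fun x z hzx => by
    rw [hf, Finset.mul_sum, ← Finset.sum_fiberwise _ (fun y => y ⊔ z)]
    refine Finset.sum_eq_zero fun w _ => ?_
    rw [Finset.filter_filter]
    calc _ = ∑ y ∈ Finset.univ.filter (fun y => x ≤ y ∧ y ⊔ z = w), μ x y • g w := by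
          refine Finset.sum_congr rfl fun y hy => ?_
          simp only [Finset.mem_filter, Finset.mem_univ, true_and] at hy
          rw [mul_smul_comm, hgmul, sup_comm, hy.2]
      _ = 0 := by
          rw [← Finset.sum_smul, moebius_sum_sup_eq_zero μ hμsum hzx, zero_smul]
  have hmul : ∀ x u : P, f x * f u = if x = u then f u else 0 := fun x u => by
    calc f x * f u
        = ∑ y ∈ Finset.univ.filter (fun y => x ≤ y ∧ y ≤ u), μ x y • f u := by
          rw [hf x, Finset.sum_mul, ← Finset.filter_filter, Finset.sum_filter (fun y => y ≤ u)]
          refine Finset.sum_congr rfl fun y _ => ?_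
          rw [smul_mul_assoc]
          split_ifs with h
          · rw [hle u y h]
          · rw [hnle u y h, smul_zero]
      _ = if x = u then f u else 0 := by
          rw [← Finset.sum_smul, hμ]
          split_ifs <;> simp
  refine ⟨fun x z => ⟨hcomm x z, hle x z, hnle x z⟩, fun x => by simp [hmul],
    fun x u hxu => by simp [hmul, hxu], ?_⟩
  calc ∑ x, f x = ∑ y, (∑ x ∈ Finset.univ.filter (fun x => ⊥ ≤ x ∧ x ≤ y), μ x y) • g y := by
        simp only [hf, Finset.sum_smul, Finset.sum_filter, bot_le, true_and]
        rw [Finset.sum_comm]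
        simp only [ite_smul, zero_smul]
    _ = 1 := by
        simp only [moebius_sum_left μ hμ, ite_smul, one_smul, zero_smul, Finset.sum_ite_eq,
          Finset.mem_univ, if_true, hg0]
end
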